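/- arXiv:2509.13617 — 2 statements merged into one kernel-verified Lean document; each statement's English description precedes it below -/
import Mathlib

section
/- Let R be an integral domain with quotient field K. Then R is a PvMD if and only if for all R-subalgebras A, B of K, the canonical multiplication map μ_{A,B} : A ⊗_R B → K, a ⊗ b ↦ ab, has GV-torsion kernel. -/
open TensorProduct

/-- A finitely generated ideal `J` is a GV-ideal if the natural map
`R → Hom_R(J, R)`, sending `r` to multiplication by `r`, is bijective. -/
def IsGVIdeal {R : Type*} [CommRing R] (J : Ideal R) : Prop :=
  J.FG ∧ Function.Bijective fun r : R => (r • J.subtype : J →ₗ[R] R)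

/-- An element `m` of an `R`-module is a GV-torsion element if it is
annihilated by some GV-ideal. -/
def IsGVTorsionElem (R : Type*) [CommRing R] {M : Type*} [AddCommGroup M] [Module R M]
    (m : M) : Prop :=
  ∃ J : Ideal R, IsGVIdeal J ∧ ∀ j ∈ J, j • m = 0

/-- `R` is a PvMD if for every nonzero finitely generated ideal `I` of `R` there is a
GV-ideal `J` with `J ⊆ I·I⁻¹` (inside the quotient field `K`). -/
def IsPvMD (R : Type*) [CommRing R] [IsDomain R] (K : Type*) [Field K] [Algebra R K]
    [IsFractionRing R K] : Prop :=
  ∀ I : Ideal R, I ≠ ⊥ → I.FG →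
    ∃ J : Ideal R, IsGVIdeal J ∧
      (J : FractionalIdeal (nonZeroDivisors R) K) ≤
        (I : FractionalIdeal (nonZeroDivisors R) K) *
          (I : FractionalIdeal (nonZeroDivisors R) K)⁻¹

/-- The canonical multiplication map `A ⊗_R B → K`, `a ⊗ b ↦ ab`, for `R`-subalgebras
`A`, `B` of `K`. -/
noncomputable def mulMap {R : Type*} [CommRing R] {K : Type*} [Field K] [Algebra R K]
    (A B : Subalgebra R K) : A ⊗[R] B →ₗ[R] K :=
  TensorProduct.lift <| LinearMap.mk₂ R (fun a b => (a : K) * (b : K))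
    (by intro x₁ x₂ y; simp [add_mul])
    (by intro r x y; simp [Algebra.smul_def]; ring)
    (by intro x y₁ y₂; simp [mul_add])
    (by intro r x y; simp [Algebra.smul_def]; ring)

/-! ### GV-ideals -/

section GVIdeal

variable {R : Type*} [CommRing R] [IsDomain R]

/-- Over a domain, a finitely generated ideal `J` is GV iff it is nonzero and `J⁻¹ = R`; here the
latter condition is expressed by divisibility, an element of `J⁻¹` being written as `a / b`. -/
theorem isGVIdeal_iff {J : Ideal R} :
    IsGVIdeal J ↔
      J.FG ∧ J ≠ ⊥ ∧ ∀ a b : R, b ≠ 0 → (∀ j ∈ J, b ∣ a * j) → b ∣ a := by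
  refine and_congr_right fun _ => ⟨fun ⟨hinj, hsurj⟩ => ?_, fun ⟨hJ, h⟩ => ?_⟩
  · have hJ : J ≠ ⊥ := by
      rintro rfl
      refine zero_ne_one (hinj (?_ : (0 : R) • _ = (1 : R) • _))
      ext ⟨x, hx⟩
      simp [(Submodule.mem_bot R).mp hx]
    refine ⟨hJ, fun a b hb h => ?_⟩
    obtain ⟨j, hj, hj0⟩ := Submodule.exists_mem_ne_zero_of_ne_bot hJ
    choose q hq using h
    let φ : J →ₗ[R] R :=
      { toFun := fun j => q j j.2
        map_add' := fun x y => mul_left_cancel₀ hb <| by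
          rw [mul_add, ← hq, ← hq, ← hq, ← mul_add]; rfl
        map_smul' := fun r x => mul_left_cancel₀ hb <| by
          rw [← hq, RingHom.id_apply, smul_eq_mul, mul_left_comm b, ← hq]
          simp [mul_left_comm] }
    obtain ⟨r, hr⟩ := hsurj φ
    have hrj : r * j = q j hj := LinearMap.congr_fun hr ⟨j, hj⟩
    refine ⟨r, mul_right_cancel₀ hj0 ?_⟩
    rw [hq j hj, ← hrj, mul_assoc]
  · obtain ⟨j, hj, hj0⟩ := Submodule.exists_mem_ne_zero_of_ne_bot hJ
    refine ⟨fun r s hrs => mul_right_cancel₀ hj0 (LinearMap.congr_fun hrs ⟨j, hj⟩), fun φ => ?_⟩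
    have key (x y : J) : (x : R) * φ y = y * φ x := by
      rw [← smul_eq_mul, ← smul_eq_mul, ← map_smul, ← map_smul]
      congr 1
      exact Subtype.ext (mul_comm _ _)
    obtain ⟨r, hr⟩ := h (φ ⟨j, hj⟩) j hj0 fun x hx =>
      ⟨φ ⟨x, hx⟩, by rw [mul_comm]; exact (key ⟨j, hj⟩ ⟨x, hx⟩).symm⟩
    refine ⟨r, LinearMap.ext fun x => mul_left_cancel₀ hj0 ?_⟩
    rw [key ⟨j, hj⟩ x, hr]
    simp only [LinearMap.smul_apply, Submodule.subtype_apply, smul_eq_mul]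
    ring

theorem IsGVIdeal.top : IsGVIdeal (⊤ : Ideal R) :=
  isGVIdeal_iff.mpr ⟨Ideal.fg_top R, top_ne_bot,
    fun a b _ h => by simpa using h 1 Submodule.mem_top⟩

theorem IsGVIdeal.mul {I J : Ideal R} (hI : IsGVIdeal I) (hJ : IsGVIdeal J) :
    IsGVIdeal (I * J) := by
  rw [isGVIdeal_iff] at *
  refine ⟨hI.1.mul hJ.1, mul_ne_zero hI.2.1 hJ.2.1, fun a b hb h => ?_⟩
  refine hI.2.2 a b hb fun i hi => hJ.2.2 _ b hb fun j hj => ?_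
  rw [mul_assoc]
  exact h _ (Ideal.mul_mem_mul hi hj)

/-- An ideal containing no GV-ideal lies in a prime ideal containing no GV-ideal. -/
theorem exists_isPrime_le_forall_not_isGVIdeal_le {I : Ideal R}
    (hI : ∀ J, IsGVIdeal J → ¬ J ≤ I) :
    ∃ P : Ideal R, P.IsPrime ∧ I ≤ P ∧ ∀ J, IsGVIdeal J → ¬ J ≤ P := by
  obtain ⟨P, hIP, hP⟩ := zorn_le_nonempty₀ {P : Ideal R | ∀ J, IsGVIdeal J → ¬ J ≤ P}
    (fun c hc hchain Q hQ => by
      refine ⟨sSup c, fun J hJ hle => ?_, fun _ => le_sSup⟩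
      obtain ⟨Q', hQ', hJQ'⟩ :=
        (CompleteLattice.isCompactElement_iff_le_of_directed_sSup_le _ J).mp
          ((Submodule.fg_iff_compact J).mp hJ.1) c ⟨Q, hQ⟩ hchain.directedOn hle
      exact hc hQ' J hJ hJQ') I hI
  refine ⟨P, ⟨?_, ?_⟩, hIP, hP.prop⟩
  · rintro rfl
    exact hP.prop ⊤ .top le_rfl
  · intro x y hxy
    by_contra! hxyP
    have aux {z : R} (hz : z ∉ P) : ∃ J, IsGVIdeal J ∧ J ≤ P ⊔ Ideal.span {z} := by
      by_contra! h
      exact hz (hP.le_of_ge h le_sup_left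
        (Ideal.mem_sup_right (Ideal.mem_span_singleton_self z)))
    obtain ⟨J₁, hJ₁, h₁⟩ := aux hxyP.1
    obtain ⟨J₂, hJ₂, h₂⟩ := aux hxyP.2
    refine hP.prop _ (hJ₁.mul hJ₂) ((Ideal.mul_mono h₁ h₂).trans ?_)
    rw [Ideal.sup_mul, Ideal.mul_sup, Ideal.mul_sup, Ideal.span_singleton_mul_span_singleton]
    simp only [sup_le_iff]
    exact ⟨⟨Ideal.mul_le_left, Ideal.mul_le_left⟩, Ideal.mul_le_right,
      (Ideal.span_singleton_le_iff_mem _).mpr hxy⟩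

end GVIdeal

/-! ### Tensor products over a local ring -/

section Local

variable {V : Type*} [CommRing V]

/-- An element outside `m M` is sent to `1` by some linear map to the residue field `V ⧸ m`. -/
theorem exists_linearMap_quotient_eq_one {M : Type*} [AddCommGroup M] [Module V M]
    (m : Ideal V) [m.IsMaximal] {e : M} (he : e ∉ (m • ⊤ : Submodule V M)) :
    ∃ f : M →ₗ[V] V ⧸ m, f e = 1 := by
  let := Ideal.Quotient.field m
  set e' : M ⧸ (m • ⊤ : Submodule V M) := Submodule.Quotient.mk e with he'
  have hne : e' ≠ 0 := by rwa [he', Ne, Submodule.Quotient.mk_eq_zero]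
  obtain ⟨f, hf⟩ : ∃ f : Module.Dual (V ⧸ m) (M ⧸ (m • ⊤ : Submodule V M)), f e' ≠ 0 := by
    by_contra! h
    exact hne ((Module.forall_dual_apply_eq_zero_iff (V ⧸ m) e').mp h)
  refine ⟨(((f e')⁻¹ • f).restrictScalars V) ∘ₗ Submodule.mkQ _, ?_⟩
  simpa [he'] using inv_mul_cancel₀ hf

theorem exists_smul_sub_mem_of_tmul_eq {M N : Type*} [AddCommGroup M] [Module V M]
    [AddCommGroup N] [Module V N] (m : Ideal V) [m.IsMaximal] {x e : M} {y e' : N}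
    (h : x ⊗ₜ[V] y = e ⊗ₜ[V] e') (he' : e' ∉ (m • ⊤ : Submodule V N)) :
    ∃ c : V, c • x - e ∈ (m • ⊤ : Submodule V M) := by
  obtain ⟨f, hf⟩ := exists_linearMap_quotient_eq_one m he'
  obtain ⟨c, hc⟩ := Ideal.Quotient.mk_surjective (f y)
  let φ : M ⊗[V] N →ₗ[V] M ⧸ (m • ⊤ : Submodule V M) :=
    TensorProduct.lift <| LinearMap.mk₂ V (fun x y => f y • Submodule.Quotient.mk x)
      (by simp) (by intro r x y; rw [Submodule.Quotient.mk_smul, smul_comm])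
      (by simp [add_smul]) (by simp)
  refine ⟨c, (Submodule.Quotient.eq _).mp ?_⟩
  have := congr_arg φ h
  simpa [φ, hf, ← hc] using this

variable {K : Type*} [Field K] [Algebra V K]

theorem tmul_eq_tmul_of_injective_mulMap {A B : Subalgebra V K}
    (H : Function.Injective (mulMap A B)) {a a' : A} {b b' : B}
    (h : (a * b : K) = a' * b') : a ⊗ₜ[V] b = a' ⊗ₜ[V] b' :=
  H (by simpa [mulMap] using h)

theorem mem_range_of_isIntegral_of_injective_mulMap
    (H : ∀ A : Subalgebra V K, Function.Injective (mulMap A A)) {x : K} (hx : IsIntegral V x) :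
    x ∈ (algebraMap V K).range := by
  let A := Algebra.adjoin V {x}
  have : Module.Finite V A := Algebra.finite_adjoin_simple_of_isIntegral hx
  have : Algebra.IsEpi V A := (Algebra.isEpi_iff_forall_one_tmul_eq V A).mpr fun a =>
    tmul_eq_tmul_of_injective_mulMap (H A) (by simp)
  obtain ⟨v, hv⟩ := (Algebra.isEpi_iff_surjective_algebraMap_of_finite (R := V) (A := A)).mp this
    ⟨x, Algebra.self_mem_adjoin_singleton V x⟩
  exact ⟨v, congr_arg Subtype.val hv⟩

variable [IsLocalRing V]

open IsLocalRing

/-- If the maximal ideal of `V` generates the unit ideal of `V[x]`, then `x⁻¹` is integral. -/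
theorem isIntegral_inv_of_one_mem_maximalIdeal_map {x : K} (hx : x ≠ 0)
    (h : (1 : Algebra.adjoin V {x}) ∈ (maximalIdeal V • ⊤ : Submodule V (Algebra.adjoin V {x}))) :
    IsIntegral V x⁻¹ := by
  let := invertibleOfNonzero hx
  rw [Ideal.smul_top_eq_map, Submodule.restrictScalars_mem] at h
  obtain ⟨p, hp, hpx⟩ :=
    Algebra.exists_aeval_invOf_eq_zero_of_idealMap_adjoin_sup_span_eq_top x
    (maximalIdeal V) Ideal.IsPrime.ne_top' (by rw [(Ideal.eq_top_iff_one _).mpr h, top_sup_eq])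
  have hu : IsUnit p.leadingCoeff := by
    by_contra hu
    have := sub_mem ((mem_maximalIdeal _).mpr hu) hp
    simp at this
  obtain ⟨c, hc⟩ := hu.exists_left_inv
  refine ⟨Polynomial.C c * p, Polynomial.monic_C_mul_of_mul_leadingCoeff_eq_one hc, ?_⟩
  rw [← Polynomial.aeval_def, map_mul, ← invOf_eq_inv, hpx, mul_zero]

/-- If all multiplication maps of `V`-subalgebras of `K` are injective, the image of the local ring
`V` in `K` contains `x` or `x⁻¹` for every `x`. -/
theorem mem_range_or_inv_mem_range_of_injective_mulMap
    (H : ∀ A B : Subalgebra V K, Function.Injective (mulMap A B)) (x : K) :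
    x ∈ (algebraMap V K).range ∨ x⁻¹ ∈ (algebraMap V K).range := by
  rcases eq_or_ne x 0 with rfl | hx
  · exact .inl (zero_mem _)
  have hint {y : K} (hy : IsIntegral V y) : y ∈ (algebraMap V K).range :=
    mem_range_of_isIntegral_of_injective_mulMap (fun A => H A A) hy
  let A := Algebra.adjoin V {x}
  by_cases hA : (1 : A) ∈ (maximalIdeal V • ⊤ : Submodule V A)
  · exact .inr (hint (isIntegral_inv_of_one_mem_maximalIdeal_map hx hA))
  left
  -- An element of `A` whose inverse is not integral is a unit of `V` modulo `m A`.
  have key (y : A) (hy : (y : K) ≠ 0) : (y : K) ∈ (algebraMap V K).range ∨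
      ∃ c : V, c • y - 1 ∈ (maximalIdeal V • ⊤ : Submodule V A) := by
    let B := Algebra.adjoin V {(y : K)⁻¹}
    by_cases hB : (1 : B) ∈ (maximalIdeal V • ⊤ : Submodule V B)
    · exact .inl (hint (by
        simpa using isIntegral_inv_of_one_mem_maximalIdeal_map (inv_ne_zero hy) hB))
    · exact .inr (exists_smul_sub_mem_of_tmul_eq (maximalIdeal V)
        (y := ⟨(y : K)⁻¹, Algebra.self_mem_adjoin_singleton V _⟩)
        (tmul_eq_tmul_of_injective_mulMap (H A B) (by simp [hy])) hB)
  let X : A := ⟨x, Algebra.self_mem_adjoin_singleton V x⟩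
  obtain h | ⟨c, hc⟩ := key X hx
  · exact h
  have hcu : IsUnit c := by
    by_contra hcu
    refine hA ?_
    have := sub_mem (Submodule.smul_mem_smul ((mem_maximalIdeal c).mpr hcu)
      (Submodule.mem_top (x := X))) hc
    simpa using this
  obtain ⟨d, hd⟩ := hcu.exists_left_inv
  have hdX : X - algebraMap V A d ∈ (maximalIdeal V • ⊤ : Submodule V A) := by
    have := Submodule.smul_mem _ d hc
    rwa [smul_sub, smul_smul, hd, one_smul, ← Algebra.algebraMap_eq_smul_one] at this
  have hsub (h : ((X - algebraMap V A d : A) : K) ∈ (algebraMap V K).range) :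
      x ∈ (algebraMap V K).range := by
    have := add_mem h ⟨d, rfl⟩
    simpa [X] using this
  by_cases h0 : ((X - algebraMap V A d : A) : K) = 0
  · exact hsub (h0 ▸ zero_mem _)
  obtain h | ⟨c', hc'⟩ := key _ h0
  · exact hsub h
  · refine absurd ?_ hA
    have := sub_mem (Submodule.smul_mem _ c' hdX) hc'
    rwa [sub_sub_cancel] at this

end Local

/-! ### Localization at a prime containing no GV-ideal -/

section Localization

variable {R : Type*} [CommRing R] {K : Type*} [Field K] [Algebra R K]

/-- If the kernels of the multiplication maps over `R` are GV-torsion and `P` contains no GV-ideal,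
then the multiplication maps over the localization of `R` at `P` are injective. -/
theorem injective_mulMap_of_isLocalization
    (H : ∀ A B : Subalgebra R K, ∀ x ∈ LinearMap.ker (mulMap A B), IsGVTorsionElem R x)
    {P : Ideal R} [P.IsPrime] (hP : ∀ J, IsGVIdeal J → ¬ J ≤ P)
    (V : Type*) [CommRing V] [Algebra R V] [IsLocalization.AtPrime V P] [Algebra V K]
    [IsScalarTower R V K] (A B : Subalgebra V K) : Function.Injective (mulMap A B) := by
  rw [← LinearMap.ker_eq_bot, LinearMap.ker_eq_bot']
  intro x hx
  let A' := A.restrictScalars R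
  let B' := B.restrictScalars R
  let π : A' ⊗[R] B' →ₗ[R] A ⊗[V] B :=
    TensorProduct.lift <| LinearMap.mk₂ R
      (fun a b => (⟨a, a.2⟩ : A) ⊗ₜ[V] (⟨b, b.2⟩ : B))
      (fun _ _ _ => TensorProduct.add_tmul ..) (fun _ _ _ => rfl)
      (fun _ _ _ => TensorProduct.tmul_add ..)
      (fun r a b => TensorProduct.tmul_smul r (⟨a, a.2⟩ : A) (⟨b, b.2⟩ : B))
  have hπ (y) : mulMap A B (π y) = mulMap A' B' y := by
    induction y with
    | zero => simp
    | add y z hy hz => simp [hy, hz]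
    | tmul a b => rfl
  obtain ⟨y, rfl⟩ : ∃ y, π y = x := by
    clear hx
    induction x with
    | zero => exact ⟨0, map_zero π⟩
    | add x x' h h' =>
      obtain ⟨y, rfl⟩ := h
      obtain ⟨y', rfl⟩ := h'
      exact ⟨y + y', map_add π y y'⟩
    | tmul a b => exact ⟨(⟨a, a.2⟩ : A') ⊗ₜ (⟨b, b.2⟩ : B'), rfl⟩
  obtain ⟨J, hJ, hJy⟩ := H A' B' y (by rw [LinearMap.mem_ker, ← hπ, hx])
  obtain ⟨s, hsJ, hsP⟩ := SetLike.not_le_iff_exists.mp (hP J hJ)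
  have hs : algebraMap R V s • π y = 0 := by
    rw [algebraMap_smul, ← map_smul, hJy s hsJ, map_zero]
  exact (IsLocalization.map_units V (⟨s, hsP⟩ : P.primeCompl)).smul_eq_zero.mp hs

/-- Elements of `R` are locally comparable for divisibility at a prime containing no GV-ideal. -/
theorem exists_notMem_dvd_or_dvd_of_mulMap [IsDomain R] [IsFractionRing R K]
    (H : ∀ A B : Subalgebra R K, ∀ x ∈ LinearMap.ker (mulMap A B), IsGVTorsionElem R x)
    {P : Ideal R} [P.IsPrime] (hP : ∀ J, IsGVIdeal J → ¬ J ≤ P) (a b : R) :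
    ∃ t ∉ P, a ∣ t * b ∨ b ∣ t * a := by
  let V := Localization.subalgebra.ofField K P.primeCompl P.primeCompl_le_nonZeroDivisors
  have : IsLocalization.AtPrime V P := Localization.subalgebra.isLocalization_ofField ..
  have : IsLocalRing V := IsLocalization.AtPrime.isLocalRing V P
  have hinj := IsFractionRing.injective R K
  have key {a b : R} (hb : b ≠ 0)
      (h : algebraMap R K a / algebraMap R K b ∈ (algebraMap V K).range) :
      ∃ t ∉ P, b ∣ t * a := by
    obtain ⟨v, hv⟩ := h
    obtain ⟨⟨r, s⟩, hrs⟩ := IsLocalization.surj P.primeCompl v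
    refine ⟨s, s.2, r, hinj ?_⟩
    have hb' : algebraMap R K b ≠ 0 := by simpa using hb
    have := congr_arg (algebraMap V K) hrs
    simp only [map_mul, hv, ← IsScalarTower.algebraMap_apply] at this ⊢
    rw [← this]
    field_simp
  rcases eq_or_ne a 0 with rfl | ha
  · exact ⟨1, P.ne_top_iff_one.mp ‹P.IsPrime›.ne_top, .inr (by simp)⟩
  rcases eq_or_ne b 0 with rfl | hb
  · exact ⟨1, P.ne_top_iff_one.mp ‹P.IsPrime›.ne_top, .inl (by simp)⟩
  obtain h | h := mem_range_or_inv_mem_range_of_injective_mulMap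
    (fun A B => injective_mulMap_of_isLocalization H hP V A B)
    (algebraMap R K a / algebraMap R K b)
  · obtain ⟨t, ht, h⟩ := key hb h
    exact ⟨t, ht, .inr h⟩
  · rw [inv_div] at h
    obtain ⟨t, ht, h⟩ := key ha h
    exact ⟨t, ht, .inl h⟩

end Localization

/-- If elements of `R` are comparable for divisibility locally at `P`, then every finitely
generated ideal is principal locally at `P`. -/
theorem Ideal.FG.exists_mem_forall_dvd_mul {R : Type*} [CommRing R] {P : Ideal R} [P.IsPrime]
    (hdvd : ∀ a b : R, ∃ t ∉ P, a ∣ t * b ∨ b ∣ t * a) {I : Ideal R} (hI : I.FG) :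
    ∃ a ∈ I, ∃ s ∉ P, ∀ x ∈ I, a ∣ s * x := by
  have hmul {s t : R} (hs : s ∉ P) (ht : t ∉ P) : s * t ∉ P :=
    P.primeCompl.mul_mem hs ht
  induction I, hI using Submodule.fg_induction with
  | singleton a =>
    refine ⟨a, Ideal.mem_span_singleton_self a, 1, P.ne_top_iff_one.mp ‹P.IsPrime›.ne_top, ?_⟩
    intro x hx
    simpa using Ideal.mem_span_singleton.mp hx
  | sup I₁ I₂ _ _ h₁ h₂ =>
    obtain ⟨a₁, ha₁, s₁, hs₁, h₁⟩ := h₁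
    obtain ⟨a₂, ha₂, s₂, hs₂, h₂⟩ := h₂
    obtain ⟨t, ht, h | h⟩ := hdvd a₁ a₂
    · refine ⟨a₁, Ideal.mem_sup_left ha₁, t * (s₁ * s₂), hmul ht (hmul hs₁ hs₂), fun x hx => ?_⟩
      obtain ⟨x₁, hx₁, x₂, hx₂, rfl⟩ := Submodule.mem_sup.mp hx
      obtain ⟨q₁, hq₁⟩ := h₁ x₁ hx₁
      obtain ⟨q₂, hq₂⟩ := h₂ x₂ hx₂
      obtain ⟨q, hq⟩ := h
      exact ⟨t * s₂ * q₁ + q * s₁ * q₂, by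
        linear_combination t * s₂ * hq₁ + t * s₁ * hq₂ + s₁ * q₂ * hq⟩
    · refine ⟨a₂, Ideal.mem_sup_right ha₂, t * (s₁ * s₂), hmul ht (hmul hs₁ hs₂), fun x hx => ?_⟩
      obtain ⟨x₁, hx₁, x₂, hx₂, rfl⟩ := Submodule.mem_sup.mp hx
      obtain ⟨q₁, hq₁⟩ := h₁ x₁ hx₁
      obtain ⟨q₂, hq₂⟩ := h₂ x₂ hx₂
      obtain ⟨q, hq⟩ := h
      exact ⟨t * s₁ * q₂ + q * s₂ * q₁, by
        linear_combination t * s₁ * hq₂ + t * s₂ * hq₁ + s₂ * q₁ * hq⟩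

section Main

variable {R : Type*} [CommRing R] [IsDomain R] {K : Type*} [Field K] [Algebra R K]
  [IsFractionRing R K]

open nonZeroDivisors

theorem isPvMD_of_forall_isGVTorsionElem_ker_mulMap
    (H : ∀ A B : Subalgebra R K, ∀ x ∈ LinearMap.ker (mulMap A B), IsGVTorsionElem R x) :
    IsPvMD R K := by
  intro I hI hIfg
  let D : Ideal R := Submodule.comap (Algebra.linearMap R K)
    ((I : FractionalIdeal R⁰ K) * (I : FractionalIdeal R⁰ K)⁻¹ : FractionalIdeal R⁰ K)
  by_contra! hD
  obtain ⟨P, hPprime, hDP, hP⟩ := exists_isPrime_le_forall_not_isGVIdeal_le (I := D)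
    fun J hJ hJD => hD J hJ <| by
      intro x hx
      obtain ⟨j, hj, rfl⟩ := (FractionalIdeal.mem_coeIdeal _).mp hx
      exact hJD hj
  obtain ⟨a, haI, s, hs, h⟩ :=
    hIfg.exists_mem_forall_dvd_mul (exists_notMem_dvd_or_dvd_of_mulMap H hP)
  have ha : a ≠ 0 := by
    rintro rfl
    obtain ⟨x, hx, hx0⟩ := Submodule.exists_mem_ne_zero_of_ne_bot hI
    have := zero_dvd_iff.mp (h x hx)
    exact mul_ne_zero (ne_of_mem_of_not_mem P.zero_mem hs).symm hx0 this
  have haK : algebraMap R K a ≠ 0 := by simpa using ha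
  refine hs (hDP (?_ : algebraMap R K s ∈
    (I : FractionalIdeal R⁰ K) * (I : FractionalIdeal R⁰ K)⁻¹))
  rw [← mul_div_cancel₀ (algebraMap R K s) haK]
  refine FractionalIdeal.mul_mem_mul (FractionalIdeal.mem_coeIdeal_of_mem _ haI) ?_
  rw [FractionalIdeal.mem_inv_iff (FractionalIdeal.coeIdeal_ne_zero.mpr hI)]
  intro y hy
  obtain ⟨x, hx, rfl⟩ := (FractionalIdeal.mem_coeIdeal _).mp hy
  obtain ⟨r, hr⟩ := h x hx
  rw [FractionalIdeal.mem_one_iff]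
  refine ⟨r, ?_⟩
  have := congr_arg (algebraMap R K) hr
  simp only [map_mul] at this
  field_simp
  linear_combination -this

theorem IsPvMD.isGVTorsionElem_of_mem_ker_mulMap (h : IsPvMD R K) (A B : Subalgebra R K)
    {x : A ⊗[R] B} (hx : x ∈ LinearMap.ker (mulMap A B)) : IsGVTorsionElem R x := by
  classical
  obtain ⟨S, rfl⟩ := TensorProduct.exists_finset x
  obtain ⟨d, hd⟩ := IsLocalization.exist_integer_multiples_of_finset R⁰
    (S.image fun p => (p.1 : K))
  replace hd : ∀ p ∈ S, ∃ r : R, algebraMap R K r = algebraMap R K d * (p.1 : K) := fun p hp => by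
    obtain ⟨r, hr⟩ := hd _ (Finset.mem_image_of_mem _ hp)
    exact ⟨r, by rw [hr, Algebra.smul_def]⟩
  have hd0 : algebraMap R K d ≠ 0 := by simp
  choose! r hr using hd
  -- The ideal `I` is `d` times the fractional ideal generated by `1` and the `p.1`.
  let I : Ideal R := Ideal.span (insert (d : R) (S.image r : Finset R))
  have hrI {p} (hp : p ∈ S) : r p ∈ I :=
    Ideal.subset_span (Set.mem_insert_of_mem _ (Finset.mem_image_of_mem r hp))
  have hdI : (d : R) ∈ I := Ideal.subset_span (Set.mem_insert _ _)
  have hI0 : I ≠ ⊥ := fun h0 => nonZeroDivisors.ne_zero d.2 ((Submodule.mem_bot R).mp (h0 ▸ hdI))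
  have hIA {z : R} (hz : z ∈ I) : algebraMap R K z / algebraMap R K d ∈ A := by
    induction hz using Submodule.span_induction with
    | zero => simp
    | add y z _ _ hy hz => rw [map_add, add_div]; exact add_mem hy hz
    | smul c z _ hz =>
      rw [smul_eq_mul, map_mul, mul_div_assoc]
      exact mul_mem (A.algebraMap_mem c) hz
    | mem z hz =>
      obtain rfl | hz := hz
      · simp
      · obtain ⟨p, hp, rfl⟩ := Finset.mem_image.mp hz
        rw [hr p hp, mul_div_cancel_left₀ _ hd0]
        exact p.1.2
  obtain ⟨J, hJ, hJI⟩ := h I hI0 ⟨insert (d : R) (S.image r), by simp [I]⟩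
  refine ⟨J, hJ, fun j hj => ?_⟩
  -- Every element of `I * I⁻¹ ⊆ R` annihilates the given tensor.
  suffices key : ∀ k ∈ (I : FractionalIdeal R⁰ K) * (I : FractionalIdeal R⁰ K)⁻¹,
      ∃ j : R, algebraMap R K j = k ∧ j • ∑ p ∈ S, p.1 ⊗ₜ[R] p.2 = 0 by
    obtain ⟨j', hj', h⟩ := key _ (hJI (FractionalIdeal.mem_coeIdeal_of_mem _ hj))
    rwa [IsFractionRing.injective R K hj'] at h
  refine fun k hk => FractionalIdeal.mul_induction_on hk (fun z hz c hc => ?_) ?_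
  · obtain ⟨n, hn, rfl⟩ := (FractionalIdeal.mem_coeIdeal _).mp hz
    rw [FractionalIdeal.mem_inv_iff (FractionalIdeal.coeIdeal_ne_zero.mpr hI0)] at hc
    have hc (z) (hz : z ∈ I) : ∃ t : R, algebraMap R K t = c * algebraMap R K z :=
      (FractionalIdeal.mem_one_iff _).mp (hc _ (FractionalIdeal.mem_coeIdeal_of_mem _ hz))
    choose! t ht using hc
    refine ⟨t n, by rw [ht n hn, mul_comm], ?_⟩
    let N : A := ⟨_, hIA hn⟩
    have hN : ∀ p ∈ S, t n • p.1 = t (r p) • N := fun p hp => Subtype.ext <| by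
      rw [Subalgebra.coe_smul, Subalgebra.coe_smul, Algebra.smul_def, Algebra.smul_def, ht n hn,
        ht _ (hrI hp), hr p hp, show (N : K) = algebraMap R K n / algebraMap R K d from rfl]
      field_simp
    have hsum : ∑ p ∈ S, t (r p) • p.2 = 0 := Subtype.ext <| by
      have hx : ∑ p ∈ S, (p.1 : K) * p.2 = 0 := by simpa [mulMap] using hx
      calc ((∑ p ∈ S, t (r p) • p.2 : B) : K)
          = ∑ p ∈ S, c * algebraMap R K d * (p.1 * p.2) := by
            rw [AddSubmonoidClass.coe_finsetSum]
            refine Finset.sum_congr rfl fun p hp => ?_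
            rw [Subalgebra.coe_smul, Algebra.smul_def, ht _ (hrI hp), hr p hp]
            ring
        _ = 0 := by rw [← Finset.mul_sum, hx, mul_zero]
    calc t n • ∑ p ∈ S, p.1 ⊗ₜ[R] p.2 = ∑ p ∈ S, N ⊗ₜ[R] (t (r p) • p.2) := by
          rw [Finset.smul_sum]
          refine Finset.sum_congr rfl fun p hp => ?_
          rw [TensorProduct.smul_tmul', hN p hp, TensorProduct.smul_tmul]
      _ = 0 := by rw [← TensorProduct.tmul_sum, hsum, TensorProduct.tmul_zero]
  · rintro _ _ ⟨j, rfl, h⟩ ⟨j', rfl, h'⟩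
    exact ⟨j + j', map_add .., by rw [add_smul, h, h', add_zero]⟩

end Main

/-- `R` is a PvMD iff for all `R`-subalgebras `A`, `B` of the quotient
field `K`, the multiplication map `A ⊗_R B → K` has GV-torsion kernel. -/
theorem pvmd_iff_mulMap_gvTorsion_kernel
    {R : Type u} [CommRing R] [IsDomain R]
    (K : Type u) [Field K] [Algebra R K] [IsFractionRing R K] :
    IsPvMD R K ↔
      ∀ (A B : Subalgebra R K),
        ∀ x ∈ LinearMap.ker (mulMap A B), IsGVTorsionElem R x := by
  exact ⟨fun h A B _ hx => h.isGVTorsionElem_of_mem_ker_mulMap A B hx,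
    isPvMD_of_forall_isGVTorsionElem_ker_mulMap⟩
end

section
/- Let R be a PvMD with quotient field K. Then for every intermediate ring T with R ⊆ T ⊆ K: (a) T is w-flat as an R-module, i.e., for every injective R-linear map A → B the kernel of the induced map A ⊗_R T → B ⊗_R T is GV-torsion; and (b) the inclusion R → T is a w-epimorphism of rings, i.e., the kernel of the multiplication map T ⊗_R T → T, t ⊗ s ↦ ts, is GV-torsion (and this map is surjective). -/
open TensorProduct

theorem isGVIdeal_top (R : Type*) [CommRing R] : IsGVIdeal (⊤ : Ideal R) := by
  refine ⟨⟨{1}, by simp⟩, fun r s h ↦ ?_, fun φ ↦ ⟨φ ⟨1, trivial⟩, ?_⟩⟩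
  · simpa using LinearMap.congr_fun h ⟨1, trivial⟩
  · ext ⟨x, hx⟩
    have hx' : (⟨x, hx⟩ : (⊤ : Ideal R)) = x • ⟨1, trivial⟩ := Subtype.ext (by simp)
    simp [hx', mul_comm]

theorem IsGVTorsionElem.of_map {R : Type*} [CommRing R] {M N : Type*} [AddCommGroup M]
    [Module R M] [AddCommGroup N] [Module R N] {m : M} (g : M →ₗ[R] N)
    (hm : IsGVTorsionElem R m) : IsGVTorsionElem R (g m) := by
  obtain ⟨J, hJ, h⟩ := hm
  exact ⟨J, hJ, fun j hj ↦ by rw [← map_smul, h j hj, map_zero]⟩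

/-- If multiplication by `r` on `M` factors through `R`, then `r` kills the kernel of
`M ⊗ A → M ⊗ B` for every injective `A → B`. -/
theorem smul_eq_zero_of_smul_factors {R : Type*} [CommRing R] {M A B : Type*}
    [AddCommGroup M] [Module R M] [AddCommGroup A] [Module R A] [AddCommGroup B] [Module R B]
    (f : A →ₗ[R] B) (hf : Function.Injective f) (r : R) (φ : M →ₗ[R] R) (m₀ : M)
    (h : ∀ m, r • m = φ m • m₀) (z : M ⊗[R] A) (hz : f.lTensor M z = 0) : r • z = 0 := by
  have h₁ : φ.rTensor A z = 0 := by
    refine Module.Flat.lTensor_preserves_injective_linearMap (M := R) f hf ?_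
    rw [map_zero, ← LinearMap.comp_apply, LinearMap.lTensor_comp_rTensor,
      ← LinearMap.rTensor_comp_lTensor, LinearMap.comp_apply, hz, map_zero]
  have h₂ : r • (LinearMap.id : M →ₗ[R] M) = LinearMap.toSpanSingleton R M m₀ ∘ₗ φ := by
    ext m
    simpa using h m
  calc r • z = (r • (LinearMap.id : M →ₗ[R] M)).rTensor A z := by
        rw [LinearMap.rTensor_smul, LinearMap.rTensor_id]; rfl
    _ = 0 := by rw [h₂, LinearMap.rTensor_comp, LinearMap.comp_apply, h₁, map_zero]

theorem exists_ideal_linearEquiv_of_fg {R : Type*} [CommRing R] [IsDomain R] (K : Type*)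
    [Field K] [Algebra R K] [IsFractionRing R K] {M : Type*} [AddCommGroup M] [Module R M]
    [Module.Finite R M] (g : M →ₗ[R] K) (hg : Function.Injective g) :
    ∃ I : Ideal R, I.FG ∧ Nonempty (M ≃ₗ[R] I) := by
  obtain ⟨s, hs⟩ := Module.Finite.fg_top (R := R) (M := M)
  obtain ⟨b, hb⟩ := IsLocalization.exist_integer_multiples (nonZeroDivisors R) s g
  have hint (m : M) : (b : R) • g m ∈ LinearMap.range (Algebra.linearMap R K) := by
    have hm : m ∈ Submodule.span R (s : Set M) := hs ▸ trivial
    induction hm using Submodule.span_induction with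
    | mem x hx => exact hb x hx
    | zero => simp
    | add x y _ _ hx hy => rw [map_add, smul_add]; exact add_mem hx hy
    | smul c x _ hx => rw [map_smul, smul_comm]; exact Submodule.smul_mem _ c hx
  have hinj : Function.Injective (Algebra.linearMap R K) := IsFractionRing.injective R K
  let ψ : M →ₗ[R] R := (LinearEquiv.ofInjective _ hinj).symm.toLinearMap ∘ₗ
    LinearMap.codRestrict _ ((b : R) • g) hint
  have hψ : Function.Injective ψ := by
    refine (LinearEquiv.ofInjective _ hinj).symm.injective.comp fun x y hxy ↦ hg ?_
    have : (b : R) • g x = (b : R) • g y := congrArg Subtype.val hxy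
    simpa [Algebra.smul_def, nonZeroDivisors.coe_ne_zero] using this
  exact ⟨LinearMap.range ψ, LinearMap.range_eq_map ψ ▸ Submodule.FG.map ψ Module.Finite.fg_top,
    ⟨LinearEquiv.ofInjective ψ hψ⟩⟩

theorem IsPvMD.isGVTorsionElem_of_lTensor_ideal {R : Type*} [CommRing R] [IsDomain R]
    {K : Type*} [Field K] [Algebra R K] [IsFractionRing R K] (hR : IsPvMD R K) (I : Ideal R)
    (hI : I.FG) {A B : Type*} [AddCommGroup A] [Module R A] [AddCommGroup B] [Module R B]
    (f : A →ₗ[R] B) (hf : Function.Injective f) (z : I ⊗[R] A) (hz : f.lTensor I z = 0) :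
    IsGVTorsionElem R z := by
  rcases eq_or_ne I ⊥ with rfl | hne
  · refine ⟨⊤, isGVIdeal_top R, fun j _ ↦
      smul_eq_zero_of_smul_factors f hf j 0 0 (fun m ↦ Subsingleton.elim _ _) z hz⟩
  obtain ⟨J, hJ, hle⟩ := hR I hne hI
  have hinj : Function.Injective (Algebra.linearMap R K) := IsFractionRing.injective R K
  have key (k : K) (hk : k ∈ (I : FractionalIdeal (nonZeroDivisors R) K) *
      (I : FractionalIdeal (nonZeroDivisors R) K)⁻¹) :
      ∃ r : R, algebraMap R K r = k ∧ r • z = 0 := by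
    refine FractionalIdeal.mul_induction_on hk (fun i hi c hc ↦ ?_) fun x y hx hy ↦ ?_
    · obtain ⟨a, ha, rfl⟩ := (FractionalIdeal.mem_coeIdeal _).1 hi
      rw [FractionalIdeal.mem_inv_iff (FractionalIdeal.coeIdeal_ne_zero.2 hne)] at hc
      have hint (m : I) : c * algebraMap R K m ∈ LinearMap.range (Algebra.linearMap R K) := by
        obtain ⟨x, hx⟩ := (FractionalIdeal.mem_one_iff _).1
          (hc _ ((FractionalIdeal.mem_coeIdeal _).2 ⟨m, m.2, rfl⟩))
        exact ⟨x, hx⟩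
      let φ : I →ₗ[R] R := (LinearEquiv.ofInjective _ hinj).symm.toLinearMap ∘ₗ
        LinearMap.codRestrict _ (LinearMap.mulLeft R c ∘ₗ Algebra.linearMap R K ∘ₗ I.subtype) hint
      have hφ (m : I) : algebraMap R K (φ m) = c * algebraMap R K m :=
        congrArg Subtype.val ((LinearEquiv.ofInjective _ hinj).apply_symm_apply ⟨_, hint m⟩)
      refine ⟨φ ⟨a, ha⟩, by rw [hφ, mul_comm],
        smul_eq_zero_of_smul_factors f hf _ φ ⟨a, ha⟩ (fun m ↦ Subtype.ext (hinj ?_)) z hz⟩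
      simp only [Algebra.linearMap_apply, Submodule.coe_smul, smul_eq_mul, map_mul, hφ]
      ring
    · obtain ⟨r, rfl, hr⟩ := hx
      obtain ⟨s, rfl, hs⟩ := hy
      exact ⟨r + s, map_add _ _ _, by rw [add_smul, hr, hs, add_zero]⟩
  refine ⟨J, hJ, fun j hj ↦ ?_⟩
  obtain ⟨r, hr, h⟩ := key _ (hle ((FractionalIdeal.mem_coeIdeal _).2 ⟨j, hj, rfl⟩))
  rwa [← hinj hr]

theorem IsPvMD.isGVTorsionElem_of_lTensor_of_finite {R : Type*} [CommRing R] [IsDomain R]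
    {K : Type*} [Field K] [Algebra R K] [IsFractionRing R K] (hR : IsPvMD R K) {M : Type*}
    [AddCommGroup M] [Module R M] [Module.Finite R M] (g : M →ₗ[R] K)
    (hg : Function.Injective g)
    {A B : Type*} [AddCommGroup A] [Module R A] [AddCommGroup B] [Module R B]
    (f : A →ₗ[R] B) (hf : Function.Injective f) (z : M ⊗[R] A) (hz : f.lTensor M z = 0) :
    IsGVTorsionElem R z := by
  obtain ⟨I, hI, ⟨e⟩⟩ := exists_ideal_linearEquiv_of_fg K g hg
  have h := hR.isGVTorsionElem_of_lTensor_ideal I hI f hf (e.toLinearMap.rTensor A z) (by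
    rw [← LinearMap.comp_apply, LinearMap.lTensor_comp_rTensor,
      ← LinearMap.rTensor_comp_lTensor, LinearMap.comp_apply, hz, map_zero])
  simpa [← LinearMap.comp_apply, ← LinearMap.rTensor_comp] using
    h.of_map (e.symm.toLinearMap.rTensor A)

theorem IsPvMD.isGVTorsionElem_of_lTensor {R : Type*} [CommRing R] [IsDomain R]
    {K : Type*} [Field K] [Algebra R K] [IsFractionRing R K] (hR : IsPvMD R K) {M : Type*}
    [AddCommGroup M] [Module R M] (g : M →ₗ[R] K) (hg : Function.Injective g)
    {A B : Type*} [AddCommGroup A] [Module R A] [AddCommGroup B] [Module R B]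
    (f : A →ₗ[R] B) (hf : Function.Injective f) (z : M ⊗[R] A) (hz : f.lTensor M z = 0) :
    IsGVTorsionElem R z := by
  obtain ⟨P, hP, t, rfl⟩ := TensorProduct.exists_of_fg z
  obtain ⟨Q, hPQ, hQ, h⟩ := TensorProduct.eq_zero_of_fg_of_subtype_eq_zero hP
    (t := f.lTensor P t) (by
      rw [← hz, ← LinearMap.comp_apply, ← LinearMap.comp_apply, LinearMap.rTensor_comp_lTensor,
        LinearMap.lTensor_comp_rTensor])
  have : Module.Finite R Q := Module.Finite.iff_fg.2 hQ
  have h' := hR.isGVTorsionElem_of_lTensor_of_finite (g ∘ₗ Q.subtype)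
    (hg.comp Q.injective_subtype) f hf ((Submodule.inclusion hPQ).rTensor A t) (by
      rw [← h, ← LinearMap.comp_apply, ← LinearMap.comp_apply, LinearMap.rTensor_comp_lTensor,
        LinearMap.lTensor_comp_rTensor])
  rw [← Submodule.subtype_comp_inclusion P Q hPQ, LinearMap.rTensor_comp]
  exact h'.of_map (Q.subtype.rTensor A)

theorem IsFractionRing.algebra_isEpi (R K : Type*) [CommRing R] [Field K] [Algebra R K]
    [IsFractionRing R K] : Algebra.IsEpi R K := by
  have : IsDomain R := (IsFractionRing.injective R K).isDomain
  refine (Algebra.isEpi_iff_forall_one_tmul_eq R K).2 fun a ↦ ?_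
  obtain ⟨r, s, hs, rfl⟩ := IsFractionRing.div_surjective (A := R) a
  have hs' : algebraMap R K s ≠ 0 := IsFractionRing.to_map_ne_zero_of_mem_nonZeroDivisors hs
  have h₁ : (1 : K) = s • (algebraMap R K s)⁻¹ := by
    rw [Algebra.smul_def, mul_inv_cancel₀ hs']
  have h₂ : s • (algebraMap R K r / algebraMap R K s) = r • (1 : K) := by
    rw [Algebra.smul_def, Algebra.smul_def, mul_div_cancel₀ _ hs', mul_one]
  have h₃ : r • (algebraMap R K s)⁻¹ = algebraMap R K r / algebraMap R K s := by
    rw [Algebra.smul_def, div_eq_mul_inv]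
  nth_rw 1 [h₁]
  rw [smul_tmul, h₂, ← smul_tmul, h₃]

/-- if `R` is a PvMD with quotient field `K`, then every intermediate
ring `R ⊆ T ⊆ K` is (a) `w`-flat as an `R`-module, and (b) the inclusion `R → T` is a
`w`-epimorphism: the multiplication map `T ⊗_R T → T` is surjective with GV-torsion
kernel. -/
theorem pvmd_overring_wflat_and_wepi
    {R : Type u} [CommRing R] [IsDomain R]
    (K : Type u) [Field K] [Algebra R K] [IsFractionRing R K]
    (hPvMD : IsPvMD R K) (T : Subalgebra R K) :
    (∀ (A B : Type u) [AddCommGroup A] [Module R A] [AddCommGroup B] [Module R B]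
      (f : A →ₗ[R] B), Function.Injective f →
        ∀ x ∈ LinearMap.ker (LinearMap.rTensor T f), IsGVTorsionElem R x) ∧
    (∀ x ∈ LinearMap.ker (LinearMap.mul' R T), IsGVTorsionElem R x) ∧
    Function.Surjective (LinearMap.mul' R T) := by
  have hT : Function.Injective T.val.toLinearMap := Subtype.val_injective
  have wflat {A B : Type u} [AddCommGroup A] [Module R A] [AddCommGroup B] [Module R B]
      (f : A →ₗ[R] B) (hf : Function.Injective f) (x : A ⊗[R] T) (hx : f.rTensor T x = 0) :
      IsGVTorsionElem R x := by
    have h := hPvMD.isGVTorsionElem_of_lTensor T.val.toLinearMap hT f hf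
      (TensorProduct.comm R A T x) (by
        rw [← LinearMap.comm_comp_rTensor_comp_comm_eq]
        simp [hx])
    simpa using h.of_map (TensorProduct.comm R T A).toLinearMap
  refine ⟨fun A B _ _ _ _ f hf x hx ↦ wflat f hf x hx, fun x hx ↦ ?_, fun t ↦ ⟨t ⊗ₜ 1, by simp⟩⟩
  refine wflat T.val.toLinearMap hT x ?_
  have : Module.Flat R K := IsLocalization.flat K (nonZeroDivisors R)
  have : Algebra.IsEpi R K := IsFractionRing.algebra_isEpi R K
  refine Module.Flat.lTensor_preserves_injective_linearMap (M := K) _ hT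
    (Algebra.IsEpi.injective_lift_mul (R := R) (A := K) ?_)
  have hcomm : lift (LinearMap.mul R K) ∘ₗ T.val.toLinearMap.lTensor K ∘ₗ
      T.val.toLinearMap.rTensor T = T.val.toLinearMap ∘ₗ LinearMap.mul' R T := by
    ext a b
    simp
  rw [map_zero, map_zero]
  exact (LinearMap.congr_fun hcomm x).trans (by simp [LinearMap.mem_ker.1 hx])
end
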